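/- Let µ be a probability measure on the unit circle S¹ ⊂ ℝ² with no atoms, and let k ≥ 2 be an integer. For R > 0 and w ∈ ℝ², set r_R(w) = ∫_{S¹} e(R⟨w, λ⟩) dµ(λ), where e(t)=exp(2πit). Then ∫_{[−1/2,1/2]²} |r_R(w)|^k dw → 0 as R → ∞. -/

import Mathlib

open MeasureTheory Filter Topology Complex
open scoped ENNReal NNReal RealInnerProductSpace

noncomputable section

/-- The Euclidean plane `ℝ²`; the torus `𝕋² = ℝ²/ℤ²` is modeled by `ℤ²`-periodic
functions on `E2` (toral eigenfunctions are automatically periodic), the fundamental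
domain `Tdom`, and Euclidean balls of radius at most `1/2`. -/
abbrev E2 := EuclideanSpace ℝ (Fin 2)

/-- The point `(a, b) ∈ ℝ²`. -/
def pt (a b : ℝ) : E2 := (WithLp.equiv 2 (Fin 2 → ℝ)).symm ![a, b]

/-- `S`: the set of positive integers expressible as a sum of two squares. -/
def sumTwoSq : Set ℕ := {n | 0 < n ∧ ∃ a b : ℤ, (n : ℤ) = a ^ 2 + b ^ 2}

/-- `S' ⊆ S` is a density one subsequence of `S`. -/
def DensityOne (S' : Set ℕ) : Prop :=
  S' ⊆ sumTwoSq ∧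
    Tendsto
      (fun X : ℕ =>
        (Nat.card {n : ℕ | n ∈ S' ∧ n ≤ X} : ℝ) /
          (Nat.card {n : ℕ | n ∈ sumTwoSq ∧ n ≤ X} : ℝ))
      atTop (𝓝 1)

/-- The lattice points `ξ ∈ ℤ²` with `|ξ|² = lam`. -/
def latticePts (lam : ℕ) : Finset (ℤ × ℤ) :=
  ((Finset.Icc (-(lam : ℤ)) lam) ×ˢ (Finset.Icc (-(lam : ℤ)) lam)).filter
    fun ξ => ξ.1 ^ 2 + ξ.2 ^ 2 = (lam : ℤ)

/-- `f` is a real-valued `L²`-normalized toral eigenfunction with eigenvalue `lam` and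
Fourier coefficients `a`: `f(x) = Σ_{|ξ|²=lam} a_ξ e(⟨ξ,x⟩)`, `a_{-ξ} = conj a_ξ`,
`Σ |a_ξ|² = 1`. -/
def IsEigenfunction (lam : ℕ) (a : ℤ × ℤ → ℂ) (f : E2 → ℝ) : Prop :=
  (∀ ξ : ℤ × ℤ, ξ ∉ latticePts lam → a ξ = 0) ∧
    (∀ ξ : ℤ × ℤ, a (-ξ) = starRingEnd ℂ (a ξ)) ∧
    (∑ ξ ∈ latticePts lam, ‖a ξ‖ ^ 2 = 1) ∧
    ∀ x : E2, (f x : ℂ) =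
      ∑ ξ ∈ latticePts lam,
        a ξ * Complex.exp (2 * (Real.pi : ℂ) * Complex.I *
          ((((ξ.1 : ℝ) * x 0 + (ξ.2 : ℝ) * x 1 : ℝ)) : ℂ))

/-- Flatness: `|a_ξ|² ≤ 100 N^{-1+ε}` for every `ε > 0`. -/
def IsFlat (lam : ℕ) (a : ℤ × ℤ → ℂ) : Prop :=
  ∀ ε : ℝ, 0 < ε → ∀ ξ ∈ latticePts lam,
    ‖a ξ‖ ^ 2 ≤ 100 * ((latticePts lam).card : ℝ) ^ (-1 + ε : ℝ)

/-- A fundamental domain `[0,1]²` for the torus `𝕋²`. -/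
def Tdom : Set E2 := {x | x 0 ∈ Set.Icc (0 : ℝ) 1 ∧ x 1 ∈ Set.Icc (0 : ℝ) 1}

/-- The square `[-1/2,1/2]²`. -/
def Qdom : Set E2 := {y | y 0 ∈ Set.Icc (-(1/2) : ℝ) (1/2) ∧ y 1 ∈ Set.Icc (-(1/2) : ℝ) (1/2)}

/-- `L(f, B)`: the `1`-dimensional Hausdorff measure of the nodal set of `f` in `B`. -/
def nodalLen (f : E2 → ℝ) (B : Set E2) : ℝ := (μH[1] ({x : E2 | f x = 0} ∩ B)).toReal

/-- `L(F_x)` where `F_x(y) = f(x + R y / √lam)` for `y ∈ [-1/2,1/2]²`, as an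
extended nonnegative real. -/
def LF (lam : ℕ) (R : ℝ) (f : E2 → ℝ) (x : E2) : ℝ≥0∞ :=
  μH[1] {y : E2 | y ∈ Qdom ∧ f (x + (R / Real.sqrt lam) • y) = 0}

/-- The pseudo-spectral measure `µ_f = Σ_ξ |a_ξ|² δ_{ξ/√lam}` on `S¹ ⊂ ℝ²`. -/
def specMeasure (lam : ℕ) (a : ℤ × ℤ → ℂ) : Measure E2 :=
  ∑ ξ ∈ latticePts lam,
    (ENNReal.ofReal (‖a ξ‖ ^ 2)) •
      Measure.dirac (pt ((ξ.1 : ℝ) / Real.sqrt lam) ((ξ.2 : ℝ) / Real.sqrt lam))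

/-- Weak-star convergence of the pseudo-spectral measures of the sequence `a` to `mu`,
along `λ → ∞`, `λ ∈ S'`. -/
def SpecTendsto (S' : Set ℕ) (a : ℕ → ℤ × ℤ → ℂ) (mu : Measure E2) : Prop :=
  ∀ g : BoundedContinuousFunction E2 ℝ,
    Tendsto (fun lam => ∫ z, g z ∂(specMeasure lam (a lam))) (atTop ⊓ 𝓟 S')
      (𝓝 (∫ z, g z ∂mu))

/-- The support of `mu` is not contained in a line. -/
def NotOnLine (mu : Measure E2) : Prop :=
  ∀ A B c : ℝ, ¬(A = 0 ∧ B = 0) → mu {x : E2 | A * x 0 + B * x 1 = c} < 1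

/-- `µ̂(2) = ∫_{S¹} z² dµ(z)`, identifying `S¹ ⊂ ℂ`. -/
def muhat2 (mu : Measure E2) : ℂ := ∫ x, ((x 0 : ℂ) + (x 1 : ℂ) * Complex.I) ^ 2 ∂mu

/-- The constant `c₁ = (1-µ̂(2)²)/(2^{5/2}π) ∫₀^{2π} (1-µ̂(2)cos 2θ)^{-3/2} dθ`
(for `µ̂(2)` real). -/
def c1const (mu : Measure E2) : ℝ :=
  ((1 - (muhat2 mu).re ^ 2) / (2 ^ ((5:ℝ)/2) * Real.pi)) *
    ∫ θ in (0:ℝ)..(2 * Real.pi), ((1 - (muhat2 mu).re * Real.cos (2 * θ)) ^ (-(3/2) : ℝ))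

theorem norm_exp_two_pi_I (x : ℝ) : ‖exp (2 * (Real.pi : ℂ) * I * (x : ℂ))‖ = 1 := by
  rw [show 2 * (Real.pi : ℂ) * I * (x : ℂ) = ((2 * Real.pi * x : ℝ) : ℂ) * I by push_cast; ring,
    norm_exp_ofReal_mul_I]

/-- A measure without atoms gives the diagonal of the product measure no mass. -/
theorem ae_fst_ne_snd (mu : Measure E2) [IsProbabilityMeasure mu] (hatoms : ∀ z : E2, mu {z} = 0) :
    ∀ᵐ p : E2 × E2 ∂(mu.prod mu), p.1 - p.2 ≠ 0 := by
  have hm : MeasurableSet {p : E2 × E2 | p.1 = p.2} := measurableSet_eq_fun (by fun_prop) (by fun_prop)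
  have h : (mu.prod mu) {p : E2 × E2 | p.1 = p.2} = 0 := by
    rw [Measure.measure_prod_null hm]
    filter_upwards with x
    rw [Pi.zero_apply]
    convert hatoms x using 2
    ext y
    simp [eq_comm]
  rw [ae_iff]
  convert h using 2
  ext p
  simp [sub_eq_zero]

theorem measurableSet_Qdom : MeasurableSet Qdom := by
  have h0 : Measurable fun y : E2 => y 0 := by fun_prop
  have h1 : Measurable fun y : E2 => y 1 := by fun_prop
  exact (h0 measurableSet_Icc).inter (h1 measurableSet_Icc)

theorem isBounded_Qdom : Bornology.IsBounded Qdom := by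
  rw [isBounded_iff_forall_norm_le]
  refine ⟨1, fun y hy => ?_⟩
  obtain ⟨⟨h1, h2⟩, h3, h4⟩ := hy
  rw [EuclideanSpace.norm_eq]
  refine Real.sqrt_le_iff.mpr ⟨zero_le_one, ?_⟩
  simp only [Fin.sum_univ_two, Real.norm_eq_abs, sq_abs]
  nlinarith

instance isFiniteMeasure_restrict_Qdom : IsFiniteMeasure ((volume : Measure E2).restrict Qdom) :=
  ⟨by simpa using isBounded_Qdom.measure_lt_top⟩

/-- The Riemann-Lebesgue lemma for the square, along a ray. -/
theorem tendsto_integral_Qdom_exp {v : E2} (hv : v ≠ 0) :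
    Tendsto (fun R : ℝ => ∫ w in Qdom, exp (2 * (Real.pi : ℂ) * I * ((R * ⟪w, v⟫ : ℝ) : ℂ)))
      atTop (𝓝 0) := by
  have hray : Tendsto (fun R : ℝ => (-R) • v) atTop (cocompact E2) := by
    rw [← Metric.cobounded_eq_cocompact, ← comap_norm_atTop, tendsto_comap_iff]
    simp only [Function.comp_def, norm_smul, norm_neg]
    exact tendsto_norm_atTop_atTop.atTop_mul_const (norm_pos_iff.mpr hv)
  have h := (tendsto_integral_exp_inner_smul_cocompact (Qdom.indicator fun _ : E2 => (1 : ℂ))).comp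
    hray
  refine h.congr fun R => ?_
  rw [← integral_indicator measurableSet_Qdom]
  refine integral_congr_ae (Eventually.of_forall fun w => ?_)
  by_cases hw : w ∈ Qdom
  · simp only [Set.indicator_of_mem hw, Circle.smul_def, Real.fourierChar_apply, inner_smul_right,
      smul_eq_mul, mul_one]
    congr 1
    push_cast
    ring
  · simp [Set.indicator_of_notMem hw]

theorem sq_norm_integral_exp (mu : Measure E2) [IsProbabilityMeasure mu] (R : ℝ) (w : E2) :
    ((‖∫ l, exp (2 * (Real.pi : ℂ) * I * ((R * ⟪w, l⟫ : ℝ) : ℂ)) ∂mu‖ ^ 2 : ℝ) : ℂ) =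
      ∫ p : E2 × E2, exp (2 * (Real.pi : ℂ) * I * ((R * ⟪w, p.1 - p.2⟫ : ℝ) : ℂ))
        ∂(mu.prod mu) := by
  push_cast
  rw [← Complex.mul_conj', ← integral_conj, ← integral_prod_mul]
  refine integral_congr_ae (Eventually.of_forall fun p => ?_)
  simp only [← exp_conj, ← Complex.exp_add, inner_sub_right, map_mul, conj_I, conj_ofReal,
    map_ofNat]
  congr 1
  push_cast
  ring

/-- The mean square of the Fourier transform is a double integral of the transform of the square. -/
theorem integral_Qdom_sq_norm (mu : Measure E2) [IsProbabilityMeasure mu] (R : ℝ) :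
    ((∫ w in Qdom, ‖∫ l, exp (2 * (Real.pi : ℂ) * I * ((R * ⟪w, l⟫ : ℝ) : ℂ)) ∂mu‖ ^ 2 : ℝ) : ℂ) =
      ∫ p : E2 × E2, (∫ w in Qdom, exp (2 * (Real.pi : ℂ) * I * ((R * ⟪w, p.1 - p.2⟫ : ℝ) : ℂ)))
        ∂(mu.prod mu) := by
  rw [← integral_complex_ofReal]
  simp only [sq_norm_integral_exp]
  refine integral_integral_swap (Integrable.of_bound (C := 1) ?_ ?_)
  · refine Continuous.aestronglyMeasurable ?_
    simp only [Function.uncurry_def]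
    fun_prop
  · exact Eventually.of_forall fun _ => (norm_exp_two_pi_I _).le

theorem tendsto_integral_Qdom_sq_norm (mu : Measure E2) [IsProbabilityMeasure mu]
    (hatoms : ∀ z : E2, mu {z} = 0) :
    Tendsto (fun R : ℝ =>
      ∫ w in Qdom, ‖∫ l, exp (2 * (Real.pi : ℂ) * I * ((R * ⟪w, l⟫ : ℝ) : ℂ)) ∂mu‖ ^ 2)
      atTop (𝓝 0) := by
  rw [← tendsto_ofReal_iff]
  simp only [ofReal_zero, integral_Qdom_sq_norm]
  rw [← integral_zero (E2 × E2) ℂ (μ := mu.prod mu)]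
  refine tendsto_integral_filter_of_dominated_convergence
    (fun _ => (volume : Measure E2).real Qdom) ?_ ?_ (integrable_const _) ?_
  · refine Eventually.of_forall fun R => ?_
    refine StronglyMeasurable.aestronglyMeasurable ?_
    refine StronglyMeasurable.integral_prod_right (f := fun (p : E2 × E2) (w : E2) =>
      exp (2 * (Real.pi : ℂ) * I * ((R * ⟪w, p.1 - p.2⟫ : ℝ) : ℂ))) ?_
    refine Continuous.stronglyMeasurable ?_
    simp only [Function.uncurry_def]
    fun_prop
  · refine Eventually.of_forall fun R => Eventually.of_forall fun p => ?_
    have h := norm_integral_le_of_norm_le_const (μ := (volume : Measure E2).restrict Qdom)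
      (Eventually.of_forall fun w => (norm_exp_two_pi_I (R * ⟪w, p.1 - p.2⟫)).le)
    simpa using h
  · filter_upwards [ae_fst_ne_snd mu hatoms] with p hp
    exact tendsto_integral_Qdom_exp hp

/-- Step 5 of the variance computation: for an atomless probability
measure `mu` on `S¹ ⊂ ℝ²` and `k ≥ 2`, the `k`-th moment of the rescaled Fourier
transform `r_R(w) = ∫_{S¹} e(R⟨w,λ⟩) dµ(λ)` over the square `[-1/2,1/2]²` tends to `0`
as `R → ∞`. -/
theorem covariance_moments_decay
    (mu : Measure E2) [IsProbabilityMeasure mu]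
    (hcirc : mu (Metric.sphere (0 : E2) 1)ᶜ = 0)
    (hatoms : ∀ z : E2, mu {z} = 0)
    (k : ℕ) (hk : 2 ≤ k) :
    Tendsto
      (fun R : ℝ =>
        ∫ w in Qdom,
          ‖∫ l, Complex.exp (2 * (Real.pi : ℂ) * Complex.I * ((R * ⟪w, l⟫ : ℝ) : ℂ)) ∂mu‖ ^ k)
      atTop (𝓝 0) := by
  have hle : ∀ (R : ℝ) (w : E2),
      ‖∫ l, exp (2 * (Real.pi : ℂ) * I * ((R * ⟪w, l⟫ : ℝ) : ℂ)) ∂mu‖ ≤ 1 := fun R w => by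
    have h := norm_integral_le_of_norm_le_const (μ := mu)
      (Eventually.of_forall fun l => (norm_exp_two_pi_I (R * ⟪w, l⟫)).le)
    simpa using h
  have hmeas : ∀ R : ℝ, StronglyMeasurable fun w : E2 =>
      ∫ l, exp (2 * (Real.pi : ℂ) * I * ((R * ⟪w, l⟫ : ℝ) : ℂ)) ∂mu := fun R => by
    refine StronglyMeasurable.integral_prod_right (f := fun (w l : E2) =>
      exp (2 * (Real.pi : ℂ) * I * ((R * ⟪w, l⟫ : ℝ) : ℂ))) ?_
    refine Continuous.stronglyMeasurable ?_
    simp only [Function.uncurry_def]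
    fun_prop
  have hint : ∀ (R : ℝ) (n : ℕ), Integrable (fun w : E2 =>
      ‖∫ l, exp (2 * (Real.pi : ℂ) * I * ((R * ⟪w, l⟫ : ℝ) : ℂ)) ∂mu‖ ^ n)
      (volume.restrict Qdom) := fun R n => by
    refine Integrable.of_bound (C := 1) ((hmeas R).norm.pow n).aestronglyMeasurable
      (Eventually.of_forall fun w => ?_)
    rw [norm_pow, norm_norm]
    exact pow_le_one₀ (norm_nonneg _) (hle R w)
  refine squeeze_zero (fun R => integral_nonneg fun w => by positivity)
    (fun R => integral_mono (hint R k) (hint R 2) fun w => ?_)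
    (tendsto_integral_Qdom_sq_norm mu hatoms)
  exact pow_le_pow_of_le_one (norm_nonneg _) (hle R w) hk
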